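/- Let J_1, …, J_N be nonempty subsets of Fin n, for each i ∈ Fin n let p(i) be the number of indices j with i ∈ J_j, and let p = min_i p(i); assume p ≥ 1. Then for every density matrix ρ ∈ Matrix X ℂ, (1/p) · Σ_{j=1}^N S(ρ_{J_j}) ≥ S(ρ), where ρ_J denotes the partial trace of ρ onto the indices in J. -/

import Mathlib

open scoped Classical

/-- Merge a configuration on `J` with a configuration on the complement of `J` into a full
configuration on `Fin n`. -/
noncomputable def merge {n : ℕ} {d : Fin n → ℕ} (J : Finset (Fin n))
    (a : ∀ i : J, Fin (d i)) (c : ∀ i : {i : Fin n // i ∉ J}, Fin (d i)) :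
    ∀ i, Fin (d i) :=
  fun i => if h : i ∈ J then a ⟨i, h⟩ else c ⟨i, h⟩

/-- The partial trace of `ρ` onto the indices in `J`:
`ρ_J(a,b) = Σ_{c} ρ((a,c),(b,c))`, tracing out the factors outside of `J`. -/
noncomputable def pTr {n : ℕ} {d : Fin n → ℕ} (J : Finset (Fin n))
    (ρ : Matrix (∀ i, Fin (d i)) (∀ i, Fin (d i)) ℂ) :
    Matrix (∀ i : J, Fin (d i)) (∀ i : J, Fin (d i)) ℂ :=
  fun a b => ∑ c : ∀ i : {i : Fin n // i ∉ J}, Fin (d i), ρ (merge J a c) (merge J b c)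

/-- The von Neumann entropy `S(ρ) = -Tr(ρ log ρ)` of a Hermitian matrix, computed via the
eigenvalues (with the convention `0 · log 0 = 0`, since `Real.log 0 = 0`). -/
noncomputable def vNEntropy {X : Type*} [Fintype X] [DecidableEq X] (ρ : Matrix X X ℂ) : ℝ :=
  if h : ρ.IsHermitian then -∑ i, (h.eigenvalues i) * Real.log (h.eigenvalues i) else 0


section SpectralWeights

open Matrix

variable {Y : Type*} [Fintype Y] [DecidableEq Y]

/-- The functional whose supremum over `X` is the resolvent form at parameter `t` of the pair
`(ρ, σ)`; it is real-linear in `(ρ, σ)`. -/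
noncomputable def resolventFunctional (t : ℝ) (ρ σ X : Matrix Y Y ℂ) : ℝ :=
  2 * (ρ * X).trace.re - (X * σ * Xᴴ).trace.re - t * (Xᴴ * ρ * X).trace.re

lemma resolventFunctional_diagonalized {U V : Matrix Y Y ℂ} (hU : Uᴴ * U = 1) (hV : Vᴴ * V = 1)
    {ρ σ : Matrix Y Y ℂ} {p q : Y → ℝ}
    (hρ : ρ = U * diagonal (fun i => (p i : ℂ)) * Uᴴ)
    (hσ : σ = V * diagonal (fun i => (q i : ℂ)) * Vᴴ) (t : ℝ) (M : Matrix Y Y ℂ) :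
    resolventFunctional t ρ σ (U * M * Vᴴ) =
      ∑ i, ∑ j, (2 * p i * (M i j * star ((Uᴴ * V) i j)).re
        - (q j + t * p i) * Complex.normSq (M i j)) := by
  have h1 : (ρ * (U * M * Vᴴ)).trace
      = (diagonal (fun i => (p i : ℂ)) * M * (Uᴴ * V)ᴴ).trace := by
    have : ρ * (U * M * Vᴴ) = U * (diagonal (fun i => (p i : ℂ)) * (Uᴴ * U) * M * Vᴴ) := by
      rw [hρ]; simp only [Matrix.mul_assoc]
    rw [this, trace_mul_comm, hU]
    simp only [Matrix.mul_assoc, conjTranspose_mul, conjTranspose_conjTranspose, Matrix.one_mul]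
  have h2 : ((U * M * Vᴴ) * σ * (U * M * Vᴴ)ᴴ).trace
      = (M * diagonal (fun i => (q i : ℂ)) * Mᴴ).trace := by
    have : (U * M * Vᴴ) * σ * (U * M * Vᴴ)ᴴ
        = U * (M * (Vᴴ * V) * diagonal (fun i => (q i : ℂ)) * (Vᴴ * V) * Mᴴ * Uᴴ) := by
      rw [hσ]
      simp only [Matrix.mul_assoc, conjTranspose_mul, conjTranspose_conjTranspose]
    rw [this, trace_mul_comm, hV]
    simp only [Matrix.mul_assoc, hU, Matrix.mul_one]
  have h3 : ((U * M * Vᴴ)ᴴ * ρ * (U * M * Vᴴ)).trace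
      = (Mᴴ * diagonal (fun i => (p i : ℂ)) * M).trace := by
    have : (U * M * Vᴴ)ᴴ * ρ * (U * M * Vᴴ)
        = V * (Mᴴ * (Uᴴ * U) * diagonal (fun i => (p i : ℂ)) * (Uᴴ * U) * M * Vᴴ) := by
      rw [hρ]
      simp only [Matrix.mul_assoc, conjTranspose_mul, conjTranspose_conjTranspose]
    rw [this, trace_mul_comm, hU]
    simp only [Matrix.mul_assoc, hV, Matrix.mul_one]
  have e1 : (diagonal (fun i => (p i : ℂ)) * M * (Uᴴ * V)ᴴ).trace.re
      = ∑ i, ∑ j, p i * (M i j * star ((Uᴴ * V) i j)).re := by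
    simp only [Matrix.trace, Matrix.diag, Matrix.mul_apply (M := diagonal _ * M),
      diagonal_mul, conjTranspose_apply, Complex.re_sum, mul_assoc, Complex.re_ofReal_mul]
  have e2 : (M * diagonal (fun i => (q i : ℂ)) * Mᴴ).trace.re
      = ∑ i, ∑ j, q j * Complex.normSq (M i j) := by
    simp only [Matrix.trace, Matrix.diag, Matrix.mul_apply (M := M * diagonal _),
      mul_diagonal, conjTranspose_apply, Complex.re_sum]
    refine Finset.sum_congr rfl fun i _ => Finset.sum_congr rfl fun j _ => ?_
    rw [mul_right_comm, Complex.star_def, Complex.mul_conj, ← Complex.ofReal_mul,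
      Complex.ofReal_re, mul_comm]
  have e3 : (Mᴴ * diagonal (fun i => (p i : ℂ)) * M).trace.re
      = ∑ i, ∑ j, p i * Complex.normSq (M i j) := by
    rw [Finset.sum_comm]
    simp only [Matrix.trace, Matrix.diag, Matrix.mul_apply (M := Mᴴ * diagonal _),
      mul_diagonal, conjTranspose_apply, Complex.re_sum]
    refine Finset.sum_congr rfl fun i _ => Finset.sum_congr rfl fun j _ => ?_
    rw [mul_comm, ← mul_assoc, Complex.star_def, Complex.mul_conj, ← Complex.ofReal_mul,
      Complex.ofReal_re, mul_comm]
  rw [resolventFunctional, h1, h2, h3, e1, e2, e3]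
  simp only [Finset.mul_sum, ← Finset.sum_sub_distrib]
  refine Finset.sum_congr rfl fun i _ => Finset.sum_congr rfl fun j _ => ?_
  ring

lemma two_mul_re_sub_le {p s : ℝ} (hs : 0 ≤ s) (hp : s = 0 → p = 0) (x w : ℂ) :
    2 * p * (x * star w).re - s * Complex.normSq x ≤ p ^ 2 * Complex.normSq w / s := by
  rcases hs.eq_or_lt with h | h
  · simp [← h, hp h.symm]
  · rw [le_div_iff₀ h]
    simp only [Complex.normSq_apply, Complex.mul_re, Complex.star_def, Complex.conj_re,
      Complex.conj_im]
    nlinarith [sq_nonneg (s * x.re - p * w.re), sq_nonneg (s * x.im - p * w.im)]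

lemma two_mul_re_sub_eq {p s : ℝ} (w : ℂ) :
    2 * p * ((((p / s : ℝ) : ℂ) * w) * star w).re - s * Complex.normSq (((p / s : ℝ) : ℂ) * w)
      = p ^ 2 * Complex.normSq w / s := by
  rw [mul_assoc (_ : ℂ) w, Complex.star_def, Complex.mul_conj, ← Complex.ofReal_mul,
    Complex.ofReal_re, Complex.normSq_mul, Complex.normSq_ofReal]
  rcases eq_or_ne s 0 with h | h
  · simp [h]
  · field_simp; ring

lemma isGreatest_resolventFunctional {U V : Matrix Y Y ℂ} (hU : Uᴴ * U = 1) (hV : Vᴴ * V = 1)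
    {ρ σ : Matrix Y Y ℂ} {p q : Y → ℝ}
    (hρ : ρ = U * diagonal (fun i => (p i : ℂ)) * Uᴴ)
    (hσ : σ = V * diagonal (fun i => (q i : ℂ)) * Vᴴ)
    (hp : ∀ i, 0 ≤ p i) (hq : ∀ i, 0 ≤ q i) {t : ℝ} (ht : 0 < t) :
    IsGreatest (Set.range (resolventFunctional t ρ σ))
      (∑ i, ∑ j, p i ^ 2 * Complex.normSq ((Uᴴ * V) i j) / (q j + t * p i)) := by
  constructor
  · refine ⟨U * Matrix.of (fun i j => ((p i / (q j + t * p i) : ℝ) : ℂ) * (Uᴴ * V) i j) * Vᴴ, ?_⟩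
    rw [resolventFunctional_diagonalized hU hV hρ hσ]
    exact Finset.sum_congr rfl fun i _ => Finset.sum_congr rfl fun j _ => two_mul_re_sub_eq _
  · rintro _ ⟨X, rfl⟩
    have hX : X = U * (Uᴴ * X * V) * Vᴴ := by
      have : U * (Uᴴ * X * V) * Vᴴ = (U * Uᴴ) * X * (V * Vᴴ) := by
        simp only [Matrix.mul_assoc]
      rw [this, mul_eq_one_comm.mp hU, mul_eq_one_comm.mp hV, Matrix.one_mul, Matrix.mul_one]
    rw [hX, resolventFunctional_diagonalized hU hV hρ hσ]
    refine Finset.sum_le_sum fun i _ => Finset.sum_le_sum fun j _ => ?_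
    have htp := mul_nonneg ht.le (hp i)
    refine two_mul_re_sub_le (add_nonneg (hq j) htp) (fun h => ?_) _ _
    have h0 : t * p i = 0 := by linarith [hq j]
    exact (mul_eq_zero.mp h0).resolve_left ht.ne'

end SpectralWeights

section RelativeEntropy

open Filter Topology

variable {κ κ' : Type*} [Fintype κ] [Fintype κ']

lemma hasDerivAt_weighted_log {m p q : ℝ} (hp : 0 ≤ p) (hq : 0 ≤ q)
    (h0 : q = 0 → p * m = 0) {t : ℝ} (ht : 0 ≤ t) :
    HasDerivAt (fun s => p * m * (Real.log (q + s * p) - Real.log q))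
      (p ^ 2 * m / (q + t * p)) t := by
  rcases hq.eq_or_lt with h | h
  · have hpm := h0 h.symm
    have : p ^ 2 * m = 0 := by rw [sq, mul_assoc, hpm, mul_zero]
    simpa [hpm, this] using hasDerivAt_const t (0 : ℝ)
  · have hpos : q + t * p ≠ 0 := by positivity
    have h1 : HasDerivAt (fun s => q + s * p) p t := by
      simpa using ((hasDerivAt_id t).mul_const p).const_add q
    exact (((h1.log hpos).sub_const (Real.log q)).const_mul (p * m)).congr_deriv (by ring)

lemma tendsto_weighted_log {m p q : ℝ} (hp : 0 ≤ p) :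
    Tendsto (fun s => p * m * (Real.log (q + s * p) - Real.log q) - p * m * Real.log s) atTop
      (𝓝 (p * m * (Real.log p - Real.log q))) := by
  rcases hp.eq_or_lt with h | h
  · simp [← h]
  · have h1 : Tendsto (fun s : ℝ => q / s + p) atTop (𝓝 p) := by
      simpa using (tendsto_const_nhds.div_atTop tendsto_id :
        Tendsto (fun s : ℝ => q / s) atTop _).add_const p
    have h2 := (((h1.log h.ne').sub_const (Real.log q))).const_mul (p * m)
    refine h2.congr' ?_
    have h3 : ∀ᶠ s : ℝ in atTop, 0 < q / s + p := h1.eventually (lt_mem_nhds h)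
    filter_upwards [h3, eventually_gt_atTop 0] with s hs hs0
    have : q + s * p = s * (q / s + p) := by field_simp
    rw [this, Real.log_mul hs0.ne' hs.ne']
    ring

/-- Relative entropies compare as the corresponding resolvent forms do. -/
lemma sum_log_le_of_resolvent_le {m p q : κ → ℝ} {m' p' q' : κ' → ℝ}
    (hp : ∀ k, 0 ≤ p k) (hq : ∀ k, 0 ≤ q k) (h0 : ∀ k, q k = 0 → p k * m k = 0)
    (hp' : ∀ k, 0 ≤ p' k) (hq' : ∀ k, 0 ≤ q' k) (h0' : ∀ k, q' k = 0 → p' k * m' k = 0)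
    (hsum : ∑ k, p' k * m' k = ∑ k, p k * m k)
    (hle : ∀ t : ℝ, 0 < t → ∑ k, p' k ^ 2 * m' k / (q' k + t * p' k)
      ≤ ∑ k, p k ^ 2 * m k / (q k + t * p k)) :
    ∑ k, p' k * m' k * (Real.log (p' k) - Real.log (q' k))
      ≤ ∑ k, p k * m k * (Real.log (p k) - Real.log (q k)) := by
  set F : ℝ → ℝ := fun s => ∑ k, p k * m k * (Real.log (q k + s * p k) - Real.log (q k)) with hF
  set F' : ℝ → ℝ :=
    fun s => ∑ k, p' k * m' k * (Real.log (q' k + s * p' k) - Real.log (q' k)) with hF'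
  have dF : ∀ t, 0 ≤ t → HasDerivAt F (∑ k, p k ^ 2 * m k / (q k + t * p k)) t := fun t ht =>
    HasDerivAt.fun_sum fun k _ => hasDerivAt_weighted_log (hp k) (hq k) (h0 k) ht
  have dF' : ∀ t, 0 ≤ t → HasDerivAt F' (∑ k, p' k ^ 2 * m' k / (q' k + t * p' k)) t :=
    fun t ht => HasDerivAt.fun_sum fun k _ => hasDerivAt_weighted_log (hp' k) (hq' k) (h0' k) ht
  have hmono : MonotoneOn (F - F') (Set.Ici 0) := by
    refine monotoneOn_of_deriv_nonneg (convex_Ici 0) ?_ ?_ ?_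
    · exact fun t ht => ((dF t ht).sub (dF' t ht)).continuousAt.continuousWithinAt
    · intro t ht
      rw [interior_Ici] at ht
      exact ((dF t ht.le).sub (dF' t ht.le)).differentiableAt.differentiableWithinAt
    · intro t ht
      rw [interior_Ici] at ht
      rw [((dF t ht.le).sub (dF' t ht.le)).deriv]
      exact sub_nonneg.mpr (hle t ht)
  have hFF : ∀ t, 0 ≤ t → F' t ≤ F t := by
    intro t ht
    have := hmono Set.self_mem_Ici ht ht
    simp only [Pi.sub_apply, hF, hF', zero_mul, add_zero, sub_self, mul_zero,
      Finset.sum_const_zero] at this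
    exact sub_nonneg.mp this
  have lim : Tendsto (fun s => F s - (∑ k, p k * m k) * Real.log s) atTop
      (𝓝 (∑ k, p k * m k * (Real.log (p k) - Real.log (q k)))) := by
    simp only [hF, Finset.sum_mul, ← Finset.sum_sub_distrib]
    exact tendsto_finsetSum _ fun k _ => tendsto_weighted_log (hp k)
  have lim' : Tendsto (fun s => F' s - (∑ k, p k * m k) * Real.log s) atTop
      (𝓝 (∑ k, p' k * m' k * (Real.log (p' k) - Real.log (q' k)))) := by
    rw [← hsum]
    simp only [hF', Finset.sum_mul, ← Finset.sum_sub_distrib]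
    exact tendsto_finsetSum _ fun k _ => tendsto_weighted_log (hp' k)
  refine le_of_tendsto_of_tendsto lim' lim ?_
  filter_upwards [eventually_ge_atTop 0] with s hs
  exact sub_le_sub_right (hFF s hs) _

end RelativeEntropy

section StrongSubadditivity

open Matrix Kronecker
open scoped ComplexOrder

/-- The entropy is determined by the roots of the characteristic polynomial. -/
lemma vNEntropy_eq_sum_roots {X : Type*} [Fintype X] [DecidableEq X] {ρ : Matrix X X ℂ}
    (h : ρ.IsHermitian) :
    vNEntropy ρ = -(ρ.charpoly.roots.map (fun z : ℂ => z.re * Real.log z.re)).sum := by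
  rw [vNEntropy, dif_pos h, h.roots_charpoly_eq_eigenvalues, Multiset.map_map]
  rfl

lemma vNEntropy_submatrix_equiv {X Y : Type*} [Fintype X] [DecidableEq X] [Fintype Y]
    [DecidableEq Y] (e : Y ≃ X) {ρ : Matrix X X ℂ} (h : ρ.IsHermitian) :
    vNEntropy (ρ.submatrix e e) = vNEntropy ρ := by
  rw [vNEntropy_eq_sum_roots (h.submatrix e), vNEntropy_eq_sum_roots h]
  have := charpoly_reindex e.symm ρ
  rw [reindex_apply, Equiv.symm_symm] at this
  rw [this]

lemma sum_normSq_row {Y : Type*} [Fintype Y] [DecidableEq Y] {W : Matrix Y Y ℂ}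
    (hW : W * Wᴴ = 1) (i : Y) : ∑ j, Complex.normSq (W i j) = 1 := by
  have := congrFun (congrFun hW i) i
  simp only [Matrix.mul_apply, conjTranspose_apply, Complex.star_def, Complex.mul_conj,
    one_apply_eq] at this
  exact_mod_cast this

/-- Partial trace over the left tensor factor. -/
def traceLeft {A Z : Type*} [Fintype A] (ρ : Matrix (A × Z) (A × Z) ℂ) : Matrix Z Z ℂ :=
  fun z z' => ∑ a, ρ (a, z) (a, z')

/-- Partial trace over the right tensor factor. -/
def traceRight {C Z : Type*} [Fintype C] (ρ : Matrix (Z × C) (Z × C) ℂ) : Matrix Z Z ℂ :=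
  fun z z' => ∑ c, ρ (z, c) (z', c)

lemma posSemidef_traceLeft {A Z : Type*} [Fintype A] {ρ : Matrix (A × Z) (A × Z) ℂ}
    (h : ρ.PosSemidef) :
    (traceLeft ρ).PosSemidef := by
  have : traceLeft ρ = ∑ a, ρ.submatrix (fun z => (a, z)) (fun z => (a, z)) := by
    ext z z'; simp [traceLeft, Matrix.sum_apply]
  rw [this]
  exact posSemidef_sum _ fun a _ => h.submatrix _

lemma posSemidef_traceRight {C Z : Type*} [Fintype C] {ρ : Matrix (Z × C) (Z × C) ℂ}
    (h : ρ.PosSemidef) :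
    (traceRight ρ).PosSemidef := by
  have : traceRight ρ = ∑ c, ρ.submatrix (fun z => (z, c)) (fun z => (z, c)) := by
    ext z z'; simp [traceRight, Matrix.sum_apply]
  rw [this]
  exact posSemidef_sum _ fun a _ => h.submatrix _

variable {A B C Z : Type*} [Fintype A] [DecidableEq A] [Fintype B] [DecidableEq B]
  [Fintype C] [DecidableEq C] [Fintype Z] [DecidableEq Z]

/-- Weights and eigenvalues expressing the relative entropy of `ρ` and `1 ⊗ Tr_A ρ`. -/
lemma exists_spectral_weights {ρ : Matrix (A × Z) (A × Z) ℂ} (h : ρ.PosSemidef) :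
    ∃ m p q : (A × Z) × (A × Z) → ℝ, (∀ k, 0 ≤ p k) ∧ (∀ k, 0 ≤ q k) ∧
      (∀ k, q k = 0 → p k * m k = 0) ∧
      ∑ k, p k * m k = ρ.trace.re ∧
      ∑ k, p k * m k * (Real.log (p k) - Real.log (q k))
        = vNEntropy (traceLeft ρ) - vNEntropy ρ ∧
      ∀ t : ℝ, 0 < t → IsGreatest
        (Set.range (resolventFunctional t ρ ((1 : Matrix A A ℂ) ⊗ₖ traceLeft ρ)))
        (∑ k, p k ^ 2 * m k / (q k + t * p k)) := by
  have hτ := posSemidef_traceLeft h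
  set τ := traceLeft ρ with hτdef
  set U : Matrix (A × Z) (A × Z) ℂ := h.1.eigenvectorUnitary.1 with hU
  set V₀ : Matrix Z Z ℂ := hτ.1.eigenvectorUnitary.1 with hV₀
  set V : Matrix (A × Z) (A × Z) ℂ := (1 : Matrix A A ℂ) ⊗ₖ V₀ with hV
  set p := h.1.eigenvalues with hp
  set q := hτ.1.eigenvalues with hq
  have hUU : Uᴴ * U = 1 := Unitary.coe_star_mul_self h.1.eigenvectorUnitary
  have hVV₀ : V₀ᴴ * V₀ = 1 := Unitary.coe_star_mul_self hτ.1.eigenvectorUnitary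
  have hVV : Vᴴ * V = 1 := by
    rw [hV, conjTranspose_kronecker, ← mul_kronecker_mul, hVV₀]
    simp
  have hρU : ρ = U * diagonal (fun i => (p i : ℂ)) * Uᴴ := h.1.spectral_theorem
  have hτV : τ = V₀ * diagonal (fun i => (q i : ℂ)) * V₀ᴴ := hτ.1.spectral_theorem
  have hσV : (1 : Matrix A A ℂ) ⊗ₖ τ
      = V * diagonal (fun i : A × Z => (q i.2 : ℂ)) * Vᴴ := by
    have : diagonal (fun i : A × Z => (q i.2 : ℂ))
        = (1 : Matrix A A ℂ) ⊗ₖ diagonal (fun i => (q i : ℂ)) := by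
      rw [← diagonal_one, diagonal_kronecker_diagonal]; simp
    rw [this, hV, conjTranspose_kronecker, ← mul_kronecker_mul, ← mul_kronecker_mul, ← hτV]
    simp
  have hp0 : ∀ i, 0 ≤ p i := h.eigenvalues_nonneg
  have hq0 : ∀ i, 0 ≤ q i := hτ.eigenvalues_nonneg
  have hrow : ∀ i, ∑ j, Complex.normSq ((Uᴴ * V) i j) = 1 := by
    refine sum_normSq_row ?_
    rw [conjTranspose_mul, conjTranspose_conjTranspose, Matrix.mul_assoc, ← Matrix.mul_assoc V,
      mul_eq_one_comm.mp hVV, Matrix.one_mul, hUU]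
  have hcol : ∀ z, ∑ a, ∑ i, p i * Complex.normSq ((Uᴴ * V) i (a, z)) = q z := by
    intro z
    have h1 : ∀ j, (∑ i, (p i * Complex.normSq ((Uᴴ * V) i j) : ℝ) : ℂ) = (Vᴴ * ρ * V) j j := by
      intro j
      have : Vᴴ * ρ * V = (Uᴴ * V)ᴴ * diagonal (fun i => (p i : ℂ)) * (Uᴴ * V) := by
        rw [hρU]
        simp only [conjTranspose_mul, conjTranspose_conjTranspose, Matrix.mul_assoc]
      rw [this, Matrix.mul_apply]
      refine Finset.sum_congr rfl fun i _ => ?_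
      rw [mul_diagonal, conjTranspose_apply, Complex.ofReal_mul, ← Complex.mul_conj,
        Complex.star_def]
      ring
    have h2 : ∑ a, (Vᴴ * ρ * V) (a, z) (a, z) = (V₀ᴴ * τ * V₀) z z := by
      simp only [Matrix.mul_apply, hV, conjTranspose_apply, kroneckerMap_apply, hτdef, traceLeft,
        Fintype.sum_prod_type, one_apply, Finset.sum_mul, Finset.mul_sum]
      simp only [apply_ite star, star_zero, ite_mul, mul_ite, zero_mul, mul_zero, one_mul,
        Finset.sum_ite_irrel, Finset.sum_const_zero,
        Finset.sum_ite_eq', Finset.mem_univ, if_true]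
      rw [Finset.sum_comm]
      exact Finset.sum_congr rfl fun _ _ => Finset.sum_comm
    have h3 : V₀ᴴ * τ * V₀ = diagonal (fun i => (q i : ℂ)) := by
      have : V₀ᴴ * τ * V₀ = (V₀ᴴ * V₀) * diagonal (fun i => (q i : ℂ)) * (V₀ᴴ * V₀) := by
        rw [hτV]; simp only [Matrix.mul_assoc]
      rw [this, hVV₀, Matrix.one_mul, Matrix.mul_one]
    rw [h3, diagonal_apply_eq] at h2
    simp only [← h1] at h2
    exact_mod_cast h2
  refine ⟨fun k => Complex.normSq ((Uᴴ * V) k.1 k.2), fun k => p k.1, fun k => q k.2.2,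
    fun k => hp0 _, fun k => hq0 _, ?_, ?_, ?_, ?_⟩
  · rintro ⟨i, a, z⟩ hz
    have hz' : q z = 0 := hz
    have := hcol z
    rw [hz', Finset.sum_eq_zero_iff_of_nonneg (fun a _ => Finset.sum_nonneg fun i _ =>
      mul_nonneg (hp0 i) (Complex.normSq_nonneg _))] at this
    have := this a (Finset.mem_univ _)
    rw [Finset.sum_eq_zero_iff_of_nonneg (fun i _ =>
      mul_nonneg (hp0 i) (Complex.normSq_nonneg _))] at this
    exact this i (Finset.mem_univ _)
  · rw [Fintype.sum_prod_type]
    simp only [← Finset.mul_sum, hrow, mul_one]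
    rw [h.1.trace_eq_sum_eigenvalues]
    simp [hp]
  · simp only [mul_sub, Finset.sum_sub_distrib]
    have e1 : ∑ k : (A × Z) × (A × Z), p k.1 * Complex.normSq ((Uᴴ * V) k.1 k.2)
        * Real.log (p k.1) = - vNEntropy ρ := by
      rw [Fintype.sum_prod_type, vNEntropy, dif_pos h.1, neg_neg]
      refine Finset.sum_congr rfl fun i _ => ?_
      dsimp only
      rw [← Finset.sum_mul, ← Finset.mul_sum, hrow, mul_one]
    have e2 : ∑ k : (A × Z) × (A × Z), p k.1 * Complex.normSq ((Uᴴ * V) k.1 k.2)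
        * Real.log (q k.2.2) = - vNEntropy τ := by
      rw [Fintype.sum_prod_type, Finset.sum_comm, Fintype.sum_prod_type, Finset.sum_comm,
        vNEntropy, dif_pos hτ.1, neg_neg]
      refine Finset.sum_congr rfl fun z _ => ?_
      rw [← hq, ← hcol z, Finset.sum_mul]
      simp only [Finset.sum_mul]
      rw [hcol z]
    rw [e1, e2]; ring
  · intro t ht
    rw [Fintype.sum_prod_type]
    exact isGreatest_resolventFunctional hUU hVV hρU hσV hp0 (fun i => hq0 i.2) ht

lemma traceRight_mul_trace {Y : Type*} [Fintype Y] (ρ : Matrix (Y × C) (Y × C) ℂ)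
    (X : Matrix Y Y ℂ) :
    (traceRight ρ * X).trace = (ρ * (X ⊗ₖ (1 : Matrix C C ℂ))).trace := by
  simp only [Matrix.trace, Matrix.diag, Matrix.mul_apply, traceRight, Fintype.sum_prod_type,
    kroneckerMap_apply, one_apply, Finset.sum_mul]
  simp
  exact Finset.sum_congr rfl fun _ _ => Finset.sum_comm

lemma trace_mul_mul_comm {W : Type*} [Fintype W] (P Q R : Matrix W W ℂ) :
    (P * Q * R).trace = (Q * (R * P)).trace := by
  rw [Matrix.mul_assoc, trace_mul_comm, Matrix.mul_assoc]

lemma resolventFunctional_traceRight {Y : Type*} [Fintype Y] [DecidableEq Y] (t : ℝ)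
    (ρ σ : Matrix (Y × C) (Y × C) ℂ) (X : Matrix Y Y ℂ) :
    resolventFunctional t (traceRight ρ) (traceRight σ) X
      = resolventFunctional t ρ σ (X ⊗ₖ (1 : Matrix C C ℂ)) := by
  have hX : (X ⊗ₖ (1 : Matrix C C ℂ))ᴴ = Xᴴ ⊗ₖ (1 : Matrix C C ℂ) := by
    rw [conjTranspose_kronecker, conjTranspose_one]
  simp only [resolventFunctional]
  rw [trace_mul_mul_comm X, trace_mul_mul_comm Xᴴ, trace_mul_mul_comm (X ⊗ₖ _),
    trace_mul_mul_comm (X ⊗ₖ _)ᴴ, hX, ← mul_kronecker_mul, ← mul_kronecker_mul,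
    Matrix.mul_one, traceRight_mul_trace, traceRight_mul_trace, traceRight_mul_trace]

lemma resolventFunctional_submatrix {X Y : Type*} [Fintype X] [DecidableEq X] [Fintype Y]
    [DecidableEq Y] (e : Y ≃ X) (t : ℝ) (ρ σ : Matrix X X ℂ) (M : Matrix Y Y ℂ) :
    resolventFunctional t (ρ.submatrix e e) (σ.submatrix e e) M
      = resolventFunctional t ρ σ (M.submatrix e.symm e.symm) := by
  have htr : ∀ P : Matrix X X ℂ, (P.submatrix e e).trace = P.trace := fun P => by
    simp only [Matrix.trace, Matrix.diag, submatrix_apply]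
    exact e.sum_comp fun x => P x x
  have hM : M = (M.submatrix e.symm e.symm).submatrix e e := by simp
  rw [hM]
  simp only [resolventFunctional, conjTranspose_submatrix, submatrix_mul_equiv, htr]
  simp

/-- **Strong subadditivity** of the von Neumann entropy. -/
theorem vNEntropy_strong_subadditivity {ρ : Matrix (A × B × C) (A × B × C) ℂ}
    (h : ρ.PosSemidef) :
    vNEntropy ρ + vNEntropy (traceRight (traceLeft ρ)) ≤
      vNEntropy (traceRight (ρ.submatrix (Equiv.prodAssoc A B C) (Equiv.prodAssoc A B C)))
        + vNEntropy (traceLeft ρ) := by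
  set e := Equiv.prodAssoc A B C with he
  have h' : (traceRight (ρ.submatrix e e)).PosSemidef := posSemidef_traceRight (h.submatrix _)
  have hcomm : traceLeft (traceRight (ρ.submatrix e e)) = traceRight (traceLeft ρ) := by
    ext b b'
    simp only [traceLeft, traceRight, submatrix_apply, he, Equiv.prodAssoc_apply]
    exact Finset.sum_comm
  have htr : (traceRight (ρ.submatrix e e)).trace = ρ.trace := by
    simp only [Matrix.trace, Matrix.diag, traceRight, submatrix_apply]
    rw [← e.sum_comp, ← Fintype.sum_prod_type']
  obtain ⟨m, p, q, hp, hq, h0, hs, hS, hG⟩ := exists_spectral_weights h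
  obtain ⟨m', p', q', hp', hq', h0', hs', hS', hG'⟩ := exists_spectral_weights h'
  have key := sum_log_le_of_resolvent_le hp hq h0 hp' hq' h0' (by rw [hs, hs', htr]) ?_
  · rw [hS, hS', hcomm] at key
    linarith
  · intro t ht
    obtain ⟨X, hX⟩ := (hG' t ht).1
    rw [← hX]
    have hσ : (1 : Matrix A A ℂ) ⊗ₖ traceLeft (traceRight (ρ.submatrix e e))
        = traceRight (((1 : Matrix A A ℂ) ⊗ₖ traceLeft ρ).submatrix e e) := by
      rw [hcomm]
      ext ⟨a, b⟩ ⟨a', b'⟩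
      simp [traceRight, he, Finset.mul_sum]
    rw [hσ, resolventFunctional_traceRight, resolventFunctional_submatrix]
    exact (hG t ht).2 ⟨_, rfl⟩

end StrongSubadditivity

section PartialTrace

open Matrix
open scoped ComplexOrder

variable {n : ℕ} {d : Fin n → ℕ}

lemma pTr_posSemidef (J : Finset (Fin n))
    {ρ : Matrix (∀ i, Fin (d i)) (∀ i, Fin (d i)) ℂ} (h : ρ.PosSemidef) :
    (pTr J ρ).PosSemidef := by
  have : pTr J ρ = ∑ c, ρ.submatrix (fun a => merge J a c) (fun a => merge J a c) := by
    ext a b; simp [pTr, Matrix.sum_apply]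
  rw [this]
  exact posSemidef_sum _ fun c _ => h.submatrix _

/-- Configurations on a disjoint union of two sets of indices are pairs of configurations. -/
def splitEquiv (d : Fin n → ℕ) (P Q R : Fin n → Prop) [DecidablePred Q]
    (h : ∀ i, P i ↔ Q i ∨ R i) (hd : ∀ i, Q i → ¬ R i) :
    (∀ i : {i // P i}, Fin (d i)) ≃ (∀ i : {i // Q i}, Fin (d i)) × (∀ i : {i // R i}, Fin (d i))
    where
  toFun x := (fun i => x ⟨i, (h i).2 (Or.inl i.2)⟩, fun i => x ⟨i, (h i).2 (Or.inr i.2)⟩)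
  invFun y i := if hQ : Q i then y.1 ⟨i, hQ⟩ else y.2 ⟨i, ((h i).1 i.2).resolve_left hQ⟩
  left_inv x := by
    funext i
    dsimp only
    split <;> rfl
  right_inv y := by
    refine Prod.ext (funext fun i => ?_) (funext fun i => ?_)
    · exact dif_pos i.2
    · exact dif_neg fun hQ => hd i hQ i.2

/-- The splitting of a configuration into its restrictions to `J` and to the complement. -/
noncomputable def mergeEquiv (d : Fin n → ℕ) (J : Finset (Fin n)) :
    (∀ i : J, Fin (d i)) × (∀ i : {i : Fin n // i ∉ J}, Fin (d i)) ≃ (∀ i, Fin (d i)) where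
  toFun y := merge J y.1 y.2
  invFun x := (fun i => x i, fun i => x i)
  left_inv y := by
    refine Prod.ext (funext fun i => ?_) (funext fun i => ?_)
    · exact dif_pos i.2
    · exact dif_neg i.2
  right_inv x := by
    funext i
    simp [merge]

lemma trace_pTr (J : Finset (Fin n)) (ρ : Matrix (∀ i, Fin (d i)) (∀ i, Fin (d i)) ℂ) :
    (pTr J ρ).trace = ρ.trace := by
  simp only [Matrix.trace, Matrix.diag, pTr]
  rw [← (mergeEquiv d J).sum_comp, Fintype.sum_prod_type]
  rfl

/-- Tracing out `K` after tracing out the complement of `J ∪ K` traces out the complement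
of `J`. -/
lemma pTr_eq_sum {L J K : Finset (Fin n)} (hu : ∀ i, i ∈ L ↔ i ∈ J ∨ i ∈ K)
    (hd : ∀ i, i ∈ J → ¬ i ∈ K)
    (ρ : Matrix (∀ i, Fin (d i)) (∀ i, Fin (d i)) ℂ) (a b : ∀ i : J, Fin (d i)) :
    pTr J ρ a b = ∑ c : ∀ i : K, Fin (d i),
      pTr L ρ ((splitEquiv d (· ∈ L) (· ∈ J) (· ∈ K) hu hd).symm (a, c))
        ((splitEquiv d (· ∈ L) (· ∈ J) (· ∈ K) hu hd).symm (b, c)) := by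
  have h1 : ∀ i, i ∉ J ↔ i ∈ K ∨ i ∉ L := fun i => by
    have := hu i
    have := hd i
    tauto
  have h2 : ∀ i, i ∈ K → ¬ i ∉ L := fun i hi => not_not.mpr ((hu i).2 (Or.inr hi))
  simp only [pTr]
  have key : ∀ (a : ∀ i : J, Fin (d i)) (c : ∀ i : K, Fin (d i))
      (r : ∀ i : {i // i ∉ L}, Fin (d i)),
      merge J a ((splitEquiv d (· ∉ J) (· ∈ K) (· ∉ L) h1 h2).symm (c, r))
        = merge L ((splitEquiv d (· ∈ L) (· ∈ J) (· ∈ K) hu hd).symm (a, c)) r := by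
    intro a c r
    funext i
    by_cases hJ : i ∈ J
    · simp [merge, splitEquiv, hJ, (hu i).2 (Or.inl hJ)]
    · by_cases hK : i ∈ K
      · simp [merge, splitEquiv, hJ, hK, (hu i).2 (Or.inr hK)]
      · have hL : i ∉ L := fun h => ((hu i).1 h).elim hJ hK
        simp [merge, splitEquiv, hJ, hK, hL]
  rw [← (splitEquiv d (· ∉ J) (· ∈ K) (· ∉ L) h1 h2).symm.sum_comp, Fintype.sum_prod_type]
  simp only [key]

/-- Strong subadditivity in terms of sets of indices. -/
lemma vNEntropy_pTr_submodular (J K : Finset (Fin n))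
    {ρ : Matrix (∀ i, Fin (d i)) (∀ i, Fin (d i)) ℂ} (h : ρ.PosSemidef) :
    vNEntropy (pTr (J ∪ K) ρ) + vNEntropy (pTr (J ∩ K) ρ)
      ≤ vNEntropy (pTr J ρ) + vNEntropy (pTr K ρ) := by
  have hd1 : ∀ i, i ∈ J \ K → ¬ i ∈ K := by simp
  have hd1' : ∀ i, i ∈ K → ¬ i ∈ J \ K := by simp +contextual
  have hd2 : ∀ i, i ∈ J ∩ K → ¬ i ∈ K \ J := by simp +contextual
  have hd3 : ∀ i, i ∈ J \ K → ¬ i ∈ J ∩ K := by simp +contextual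
  have hd4 : ∀ i, i ∈ J → ¬ i ∈ K \ J := by simp +contextual
  have hu1 : ∀ i, i ∈ J ∪ K ↔ i ∈ J \ K ∨ i ∈ K := fun i => by
    simp only [Finset.mem_union, Finset.mem_sdiff]; tauto
  have hu2 : ∀ i, i ∈ K ↔ i ∈ J ∩ K ∨ i ∈ K \ J := fun i => by
    simp only [Finset.mem_inter, Finset.mem_sdiff]; tauto
  have hu3 : ∀ i, i ∈ J ↔ i ∈ J \ K ∨ i ∈ J ∩ K := fun i => by
    simp only [Finset.mem_inter, Finset.mem_sdiff]; tauto
  have hu4 : ∀ i, i ∈ J ∪ K ↔ i ∈ J ∨ i ∈ K \ J := fun i => by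
    simp only [Finset.mem_union, Finset.mem_sdiff]; tauto
  let eK := splitEquiv d (· ∈ K) (· ∈ J ∩ K) (· ∈ K \ J) hu2 hd2
  let eJ := splitEquiv d (· ∈ J) (· ∈ J \ K) (· ∈ J ∩ K) hu3 hd3
  let e := (splitEquiv d (· ∈ J ∪ K) (· ∈ J \ K) (· ∈ K) hu1 hd1).trans
    ((Equiv.refl _).prodCongr eK)
  let ω := (pTr (J ∪ K) ρ).submatrix e.symm e.symm
  have hω : ω.PosSemidef := (pTr_posSemidef _ h).submatrix _
  have key := vNEntropy_strong_subadditivity hω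
  have e1 : vNEntropy ω = vNEntropy (pTr (J ∪ K) ρ) :=
    vNEntropy_submatrix_equiv _ (pTr_posSemidef _ h).1
  have m2 : traceLeft ω = (pTr K ρ).submatrix eK.symm eK.symm := by
    ext z z'
    simp only [traceLeft, submatrix_apply]
    rw [pTr_eq_sum (fun i => (hu1 i).trans or_comm) hd1']
    have hc : ∀ a x, e.symm (a, x) = (splitEquiv d (· ∈ J ∪ K) (· ∈ K) (· ∈ J \ K)
        (fun i => (hu1 i).trans or_comm) hd1').symm (eK.symm x, a) := by
      intro a x
      funext ⟨i, hi⟩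
      by_cases hK : i ∈ K
      · simp [e, splitEquiv, hK]
      · simp [e, splitEquiv, hK, (Finset.mem_union.mp hi).resolve_right hK]
    simp only [ω, submatrix_apply, hc]
  have m3 : traceRight (traceLeft ω) = pTr (J ∩ K) ρ := by
    rw [m2]
    ext z z'
    simp only [traceRight, submatrix_apply]
    rw [pTr_eq_sum hu2 hd2]
  have m4 : traceRight (ω.submatrix (Equiv.prodAssoc _ _ _) (Equiv.prodAssoc _ _ _))
      = (pTr J ρ).submatrix eJ.symm eJ.symm := by
    ext z z'
    simp only [traceRight, submatrix_apply]
    rw [pTr_eq_sum hu4 hd4]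
    have hc : ∀ x c, e.symm (Equiv.prodAssoc _ _ _ (x, c)) = (splitEquiv d (· ∈ J ∪ K) (· ∈ J)
        (· ∈ K \ J) hu4 hd4).symm (eJ.symm x, c) := by
      intro x c
      funext ⟨i, hi⟩
      by_cases hJ : i ∈ J
      · by_cases hK : i ∈ K
        · simp [e, eJ, eK, splitEquiv, hJ, hK]
        · simp [e, eJ, eK, splitEquiv, hJ, hK]
      · simp [e, eJ, eK, splitEquiv, hJ]
    simp only [ω, submatrix_apply, hc]
  rw [e1, m3, m4, m2, vNEntropy_submatrix_equiv _ (pTr_posSemidef _ h).1,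
    vNEntropy_submatrix_equiv _ (pTr_posSemidef _ h).1] at key
  exact key

end PartialTrace

section Shearer

/-- A submodular nonnegative set function vanishing at `∅` satisfies Shearer's inequality. -/
lemma submodular_covering_sum_le {α ι : Type*} [Fintype α] [DecidableEq α]
    (f : Finset α → ℝ) (hsub : ∀ J K, f (J ∪ K) + f (J ∩ K) ≤ f J + f K)
    (hnonneg : ∀ J, 0 ≤ f J) (hempty : f ∅ = 0) (J : ι → Finset α) (p : ℕ) (s : Finset ι)
    (hp : ∀ i, p ≤ (s.filter (fun j => i ∈ J j)).card) :
    p * f Finset.univ ≤ ∑ j ∈ s, f (J j) := by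
  classical
  let L : Finset ι → ℕ → Finset α :=
    fun s m => Finset.univ.filter fun i => m ≤ (s.filter (fun j => i ∈ J j)).card
  have main : ∀ s : Finset ι, ∑ m ∈ Finset.range p, f (L s (m + 1)) ≤ ∑ j ∈ s, f (J j) := by
    intro s
    induction s using Finset.induction_on with
    | empty =>
      have : ∀ m, L ∅ (m + 1) = ∅ := fun m => by simp [L]
      simp [this, hempty]
    | insert j s hj ih =>
      rw [Finset.sum_insert hj]
      have hL : ∀ m, L (insert j s) (m + 1) = L s (m + 1) ∪ (L s m ∩ J j) := by
        intro m
        ext i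
        simp only [L, Finset.mem_filter, Finset.mem_univ, true_and, Finset.mem_union,
          Finset.mem_inter, Finset.filter_insert]
        split_ifs with hi
        · rw [Finset.card_insert_of_notMem (by simp [hj])]
          simp only [hi, and_true]
          omega
        · simp [hi]
      have hstep : ∀ m, f (L (insert j s) (m + 1)) + f (L s (m + 1) ∩ J j)
          ≤ f (L s (m + 1)) + f (L s m ∩ J j) := by
        intro m
        have h1 : L s (m + 1) ∩ (L s m ∩ J j) = L s (m + 1) ∩ J j := by
          ext i
          simp only [L, Finset.mem_filter, Finset.mem_univ, true_and, Finset.mem_inter]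
          constructor
          · tauto
          · exact fun h => ⟨h.1, by omega, h.2⟩
        have := hsub (L s (m + 1)) (L s m ∩ J j)
        rwa [h1, ← hL] at this
      have htel : ∀ M, ∑ m ∈ Finset.range M, f (L (insert j s) (m + 1)) + f (L s M ∩ J j)
          ≤ ∑ m ∈ Finset.range M, f (L s (m + 1)) + f (J j) := by
        intro M
        induction M with
        | zero =>
          have : L s 0 = Finset.univ := by simp [L]
          simp [this]
        | succ M ihM =>
          rw [Finset.sum_range_succ, Finset.sum_range_succ]
          linarith [hstep M]
      linarith [htel p, hnonneg (L s p ∩ J j)]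
  refine le_trans (le_of_eq ?_) (main s)
  have : ∀ m ∈ Finset.range p, f (L s (m + 1)) = f Finset.univ := by
    intro m hm
    congr 1
    ext i
    simp only [L, Finset.mem_filter, Finset.mem_univ, true_and, iff_true]
    exact (Finset.mem_range.mp hm).trans_le (hp i)
  rw [Finset.sum_congr rfl this]
  simp

end Shearer

section EntropyBounds

open Matrix
open scoped ComplexOrder

variable {X : Type*} [Fintype X] [DecidableEq X]

lemma sum_eigenvalues_eq_one {ρ : Matrix X X ℂ} (h : ρ.IsHermitian) (h1 : ρ.trace = 1) :
    ∑ i, h.eigenvalues i = 1 := by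
  have := h.trace_eq_sum_eigenvalues
  rw [h1] at this
  refine Complex.ofReal_injective ?_
  rw [Complex.ofReal_one, this]
  simp

lemma vNEntropy_nonneg {ρ : Matrix X X ℂ} (h : ρ.PosSemidef) (h1 : ρ.trace = 1) :
    0 ≤ vNEntropy ρ := by
  rw [vNEntropy, dif_pos h.1, ← Finset.sum_neg_distrib]
  refine Finset.sum_nonneg fun i _ => ?_
  have hle : h.1.eigenvalues i ≤ 1 := by
    rw [← sum_eigenvalues_eq_one h.1 h1]
    exact Finset.single_le_sum (fun j _ => h.eigenvalues_nonneg j) (Finset.mem_univ i)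
  have := mul_nonpos_of_nonneg_of_nonpos (h.eigenvalues_nonneg i)
    (Real.log_nonpos (h.eigenvalues_nonneg i) hle)
  linarith

lemma vNEntropy_eq_zero_of_unique [Unique X] {ρ : Matrix X X ℂ} (h : ρ.IsHermitian)
    (h1 : ρ.trace = 1) : vNEntropy ρ = 0 := by
  have := sum_eigenvalues_eq_one h h1
  rw [Fintype.sum_unique] at this
  rw [vNEntropy, dif_pos h, Fintype.sum_unique, this]
  simp

end EntropyBounds

lemma vNEntropy_pTr_univ {n : ℕ} {d : Fin n → ℕ}
    {ρ : Matrix (∀ i, Fin (d i)) (∀ i, Fin (d i)) ℂ} (h : ρ.IsHermitian) :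
    vNEntropy (pTr Finset.univ ρ) = vNEntropy ρ := by
  let e : (∀ i : (Finset.univ : Finset (Fin n)), Fin (d i)) ≃ ∀ i, Fin (d i) :=
    { toFun := fun a i => a ⟨i, Finset.mem_univ i⟩
      invFun := fun x i => x i
      left_inv := fun _ => rfl
      right_inv := fun _ => rfl }
  have : pTr Finset.univ ρ = ρ.submatrix e e := by
    ext a b
    have hm : ∀ (a : ∀ i : (Finset.univ : Finset (Fin n)), Fin (d i)) c,
        merge Finset.univ a c = e a := by
      intro a c
      funext i
      simp [merge, e]
    have : IsEmpty {i : Fin n // i ∉ Finset.univ} := ⟨fun i => i.2 (Finset.mem_univ _)⟩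
    simp [pTr, hm]
  rw [this, vNEntropy_submatrix_equiv e h]

open scoped ComplexOrder in
/-- Generalized subadditivity of entropy for tensor products: if each index `i` belongs to
at least `p` of the sets `J j` (and `p` is the minimum of these counts), then
`(1/p) Σ_j S(ρ_{J_j}) ≥ S(ρ)` for every density matrix `ρ`. -/
theorem generalized_subadditivity_tensor {n N : ℕ} (hn : 1 ≤ n)
    (d : Fin n → ℕ) (hd : ∀ i, 1 ≤ d i)
    (J : Fin N → Finset (Fin n)) (hJ : ∀ j, (J j).Nonempty)
    (p : ℕ)
    (hmin : ∀ i : Fin n, p ≤ (Finset.univ.filter (fun j => i ∈ J j)).card)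
    (hattain : ∃ i : Fin n, p = (Finset.univ.filter (fun j => i ∈ J j)).card)
    (hp1 : 1 ≤ p)
    (ρ : Matrix (∀ i, Fin (d i)) (∀ i, Fin (d i)) ℂ)
    (hρ : ρ.PosSemidef) (hρ1 : ρ.trace = 1) :
    ((1 : ℝ) / p) * ∑ j, vNEntropy (pTr (J j) ρ) ≥ vNEntropy ρ := by
  have hp0 : (0 : ℝ) < p := by exact_mod_cast hp1
  have hpsd := fun K : Finset (Fin n) => pTr_posSemidef K hρ
  have htr := fun K : Finset (Fin n) => (trace_pTr K ρ).trans hρ1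
  have key := submodular_covering_sum_le (fun K => vNEntropy (pTr K ρ))
    (fun K L => vNEntropy_pTr_submodular K L hρ) (fun K => vNEntropy_nonneg (hpsd K) (htr K))
    (vNEntropy_eq_zero_of_unique (hpsd ∅).1 (htr ∅)) J p Finset.univ hmin
  simp only [vNEntropy_pTr_univ hρ.1] at key
  rw [ge_iff_le, one_div, ← div_eq_inv_mul, le_div_iff₀ hp0]
  linarith
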